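/- arXiv:math/0703383 — 9 statements merged into one kernel-verified Lean document; each statement's English description precedes it below -/
import Mathlib

section
/- For every integer l ≤ −1, the only derivation of the Lie algebra 𝔪₀ of weight l is the zero map. -/
open Finsupp

variable (K : Type*) [Field K] [CharZero K]

/-- Underlying space of `𝔪₀`: index `n : ℕ` represents the basis vector `e_{n+1}`. -/
abbrev V := ℕ →₀ K

/-- `e K i` is the basis vector `e_i` of `𝔪₀` for `i ≥ 1`, and `0` for `i ≤ 0`. -/
noncomputable def e (i : ℤ) : V K :=
  if 1 ≤ i then Finsupp.single (i - 1).toNat 1 else 0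

/-- Structure constants of `𝔪₀`: the value of the bracket `[e_{i+1}, e_{j+1}]`,
so that `[e_1, e_i] = e_{i+1}` for `i ≥ 2` and `[e_i, e_j] = 0` for `i, j ≥ 2`. -/
noncomputable def m0c (i j : ℕ) : V K :=
  if i = 0 ∧ 1 ≤ j then Finsupp.single (j + 1) 1
  else if j = 0 ∧ 1 ≤ i then -Finsupp.single (i + 1) 1
  else 0

/-- The (bilinear, skew-symmetric) bracket of `𝔪₀`, extended bilinearly from its
values on basis vectors. -/
noncomputable def m0br (x y : V K) : V K :=
  x.sum fun i xi => y.sum fun j yj => (xi * yj) • m0c K i j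

/-- `D` is a derivation of `𝔪₀` of weight `l`: a `K`-linear map satisfying the Leibniz
rule, such that `D e_i` is a scalar multiple of `e_{i+l}` for every `i ≥ 1`
(in particular `D e_i = 0` whenever `i + l ≤ 0`, since then `e (i+l) = 0`). -/
def IsWeightDeriv (l : ℤ) (D : V K →ₗ[K] V K) : Prop :=
  (∀ x y : V K, D (m0br K x y) = m0br K (D x) y + m0br K x (D y)) ∧
  (∀ i : ℤ, 1 ≤ i → ∃ c : K, D (e K i) = c • e K (i + l))

lemma m0br_single_single (i j : ℕ) (a b : K) :
    m0br K (Finsupp.single i a) (Finsupp.single j b) = (a * b) • m0c K i j := by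
  simp [m0br]

lemma m0br_zero_left (y : V K) : m0br K 0 y = 0 := by
  simp [m0br]

lemma m0br_zero_right (x : V K) : m0br K x 0 = 0 := by
  simp [m0br]

/-- `e_{n+1}` is the basis vector of index `n`. -/
lemma e_natCast_add_one (n : ℕ) : e K ((n : ℤ) + 1) = Finsupp.single n 1 := by
  simp [e]

/-- A derivation of negative weight kills `e_1`. -/
lemma IsWeightDeriv.map_single_zero {l : ℤ} (hl : l ≤ -1) {D : V K →ₗ[K] V K}
    (hD : IsWeightDeriv K l D) : D (Finsupp.single 0 1) = 0 := by
  obtain ⟨c, hc⟩ := hD.2 1 le_rfl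
  have h := e_natCast_add_one K 0
  simp only [Nat.cast_zero, zero_add] at h
  rw [← h, hc, e, if_neg (by omega), smul_zero]

/-- A derivation of negative weight maps `e_2` to a multiple of `e_1`. -/
lemma IsWeightDeriv.exists_map_single_one {l : ℤ} (hl : l ≤ -1) {D : V K →ₗ[K] V K}
    (hD : IsWeightDeriv K l D) : ∃ c : K, D (Finsupp.single 1 1) = Finsupp.single 0 c := by
  obtain ⟨c, hc⟩ := hD.2 2 (by norm_num)
  have h := e_natCast_add_one K 1
  norm_num at h
  rw [h] at hc
  by_cases hl' : l = -1
  · subst hl'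
    exact ⟨c, by rw [hc]; simp [e]⟩
  · exact ⟨0, by rw [hc, e, if_neg (by omega)]; simp⟩

/-- A derivation of negative weight kills `e_i` for every `i ≥ 3`. -/
lemma IsWeightDeriv.map_single_add_two {l : ℤ} (hl : l ≤ -1) {D : V K →ₗ[K] V K}
    (hD : IsWeightDeriv K l D) (n : ℕ) : D (Finsupp.single (n + 2) 1) = 0 := by
  have step (j : ℕ) : D (Finsupp.single (j + 2) 1) =
      m0br K (Finsupp.single 0 1) (D (Finsupp.single (j + 1) 1)) := by
    have h := hD.1 (Finsupp.single 0 1) (Finsupp.single (j + 1) 1)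
    rw [hD.map_single_zero K hl, m0br_zero_left, zero_add, m0br_single_single] at h
    simpa [m0c] using h
  induction n with
  | zero =>
    obtain ⟨c, hc⟩ := hD.exists_map_single_one K hl
    rw [step, zero_add, hc, m0br_single_single]
    simp [m0c]
  | succ n ih => rw [step, ih, m0br_zero_right]

/-- A derivation of negative weight kills `e_2`. -/
lemma IsWeightDeriv.map_single_one {l : ℤ} (hl : l ≤ -1) {D : V K →ₗ[K] V K}
    (hD : IsWeightDeriv K l D) : D (Finsupp.single 1 1) = 0 := by
  obtain ⟨c, hc⟩ := hD.exists_map_single_one K hl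
  have h := hD.1 (Finsupp.single 1 1) (Finsupp.single 2 1)
  rw [hc, hD.map_single_add_two K hl 0, m0br_zero_right, add_zero, m0br_single_single,
    m0br_single_single] at h
  have hc0 : c = 0 := by simpa [m0c, eq_comm] using h
  rw [hc, hc0, Finsupp.single_zero]

/-- For every integer `l ≤ -1`, the only derivation of `𝔪₀` of weight `l` is zero. -/
theorem negative_weight_derivations_vanish :
    ∀ l : ℤ, l ≤ -1 → ∀ D : V K →ₗ[K] V K, IsWeightDeriv K l D → D = 0 := by
  intro l hl D hD
  refine Finsupp.lhom_ext' fun n => LinearMap.ext_ring ?_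
  match n with
  | 0 => simpa using hD.map_single_zero K hl
  | 1 => simpa using hD.map_single_one K hl
  | n + 2 => simpa using hD.map_single_add_two K hl n
end

section
/- With the commutator [A,B] := A∘B − B∘A of linear endomorphisms of V, the maps ω₁, ω₂, γ and α_l (l ≥ 2) satisfy: [ω₁,ω₂] = 0, [ω₁,γ] = −γ, [ω₂,γ] = γ, [ω₁,α_l] = l·α_l, [ω₂,α_l] = 0, [α_l,α_m] = 0 for all l,m ≥ 2, and [α_l,γ] = −ad(e_{l+1}), where ad(e_{l+1}) : x ↦ [e_{l+1},x] is an inner derivation of 𝔪₀. -/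
open Finsupp

variable (K : Type*) [Field K] [CharZero K]

/-- The linear map on `V` determined by prescribing the images of the basis vectors:
`basisMap K f` sends the basis vector with index `n` (i.e. `e_{n+1}`) to `f n`. -/
noncomputable def basisMap (f : ℕ → V K) : V K →ₗ[K] V K :=
  Finsupp.lsum K fun n => LinearMap.toSpanSingleton K (V K) (f n)

/-- `ω₁`: `ω₁ e_1 = e_1`, `ω₁ e_2 = 0`, `ω₁ e_k = (k-2) e_k` for `k ≥ 3`. -/
noncomputable def omega1 : V K →ₗ[K] V K :=
  basisMap K fun n => if n = 0 then Finsupp.single 0 1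
    else ((n : K) - 1) • Finsupp.single n 1

/-- `ω₂`: `ω₂ e_1 = 0`, `ω₂ e_k = e_k` for `k ≥ 2`. -/
noncomputable def omega2 : V K →ₗ[K] V K :=
  basisMap K fun n => if n = 0 then 0 else Finsupp.single n 1


/-- `α_l`: `α_l e_1 = 0`, `α_l e_k = e_{k+l}` for `k ≥ 2`. -/
noncomputable def alphaMap (l : ℤ) : V K →ₗ[K] V K :=
  basisMap K fun n => if n = 0 then 0 else Finsupp.single ((n : ℤ) + l).toNat 1

/-- `γ`: `γ e_1 = e_2`, `γ e_k = 0` for `k ≥ 2`. -/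
noncomputable def gammaMap : V K →ₗ[K] V K :=
  basisMap K fun n => if n = 0 then Finsupp.single 1 1 else 0

/-- The inner derivation `ad(e_{n+1}) : x ↦ [e_{n+1}, x]` of `𝔪₀`. -/
noncomputable def adE (n : ℕ) : V K →ₗ[K] V K :=
  basisMap K fun j => m0c K n j


theorem basisMap_single (f : ℕ → V K) (n : ℕ) (c : K) :
    basisMap K f (Finsupp.single n c) = c • f n := by
  simp [basisMap]

theorem omega1_single_zero (c : K) :
    omega1 K (Finsupp.single 0 c) = Finsupp.single 0 c := by
  simp [omega1, basisMap_single]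

theorem omega1_single_succ (n : ℕ) (c : K) :
    omega1 K (Finsupp.single (n + 1) c) = Finsupp.single (n + 1) (c * n) := by
  simp [omega1, basisMap_single]

theorem omega2_single_zero (c : K) : omega2 K (Finsupp.single 0 c) = 0 := by
  simp [omega2, basisMap_single]

theorem omega2_single_succ (n : ℕ) (c : K) :
    omega2 K (Finsupp.single (n + 1) c) = Finsupp.single (n + 1) c := by
  simp [omega2, basisMap_single]

theorem gammaMap_single_zero (c : K) :
    gammaMap K (Finsupp.single 0 c) = Finsupp.single 1 c := by
  simp [gammaMap, basisMap_single]

theorem gammaMap_single_succ (n : ℕ) (c : K) :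
    gammaMap K (Finsupp.single (n + 1) c) = 0 := by
  simp [gammaMap, basisMap_single]

theorem alphaMap_single_zero (l : ℤ) (c : K) :
    alphaMap K l (Finsupp.single 0 c) = 0 := by
  simp [alphaMap, basisMap_single]

theorem alphaMap_natCast_single_succ (l n : ℕ) (c : K) :
    alphaMap K l (Finsupp.single (n + 1) c) = Finsupp.single (n + l + 1) c := by
  have h : (((n + 1 : ℕ) : ℤ) + l).toNat = n + l + 1 := by omega
  simp only [alphaMap, basisMap_single, h]
  simp

theorem adE_succ_single_zero (n : ℕ) (c : K) :
    adE K (n + 1) (Finsupp.single 0 c) = -Finsupp.single (n + 2) c := by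
  simp [adE, basisMap_single, m0c]

theorem adE_succ_single_succ (n j : ℕ) (c : K) :
    adE K (n + 1) (Finsupp.single (j + 1) c) = 0 := by
  simp [adE, basisMap_single, m0c]

/-- Two endomorphisms of `V` agree if they agree on `e_1` and on every `e_{n+2}`. -/
theorem linearMap_ext_zero_succ {A B : V K →ₗ[K] V K}
    (h0 : A (Finsupp.single 0 1) = B (Finsupp.single 0 1))
    (hs : ∀ n : ℕ, A (Finsupp.single (n + 1) 1) = B (Finsupp.single (n + 1) 1)) : A = B := by
  refine Finsupp.lhom_ext' fun n => LinearMap.ext_ring ?_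
  cases n with
  | zero => exact h0
  | succ n => exact hs n

/-- The bracket structure on the weight-graded derivations of `𝔪₀`, where
`[A, B] := A ∘ B - B ∘ A` is the commutator of linear endomorphisms:
`[ω₁,ω₂] = 0`, `[ω₁,γ] = -γ`, `[ω₂,γ] = γ`, `[ω₁,α_l] = l·α_l`, `[ω₂,α_l] = 0`,
`[α_l,α_m] = 0`, and `[α_l,γ] = -ad(e_{l+1})`. -/
theorem bracket_structure_on_H1 :
    omega1 K ∘ₗ omega2 K - omega2 K ∘ₗ omega1 K = 0 ∧
    omega1 K ∘ₗ gammaMap K - gammaMap K ∘ₗ omega1 K = -gammaMap K ∧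
    omega2 K ∘ₗ gammaMap K - gammaMap K ∘ₗ omega2 K = gammaMap K ∧
    (∀ l : ℤ, 2 ≤ l →
      omega1 K ∘ₗ alphaMap K l - alphaMap K l ∘ₗ omega1 K = (l : K) • alphaMap K l) ∧
    (∀ l : ℤ, 2 ≤ l →
      omega2 K ∘ₗ alphaMap K l - alphaMap K l ∘ₗ omega2 K = 0) ∧
    (∀ l m : ℤ, 2 ≤ l → 2 ≤ m →
      alphaMap K l ∘ₗ alphaMap K m - alphaMap K m ∘ₗ alphaMap K l = 0) ∧
    (∀ l : ℤ, 2 ≤ l →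
      alphaMap K l ∘ₗ gammaMap K - gammaMap K ∘ₗ alphaMap K l = -adE K l.toNat) := by
  have one_eq : ∀ c : K, Finsupp.single 1 c = Finsupp.single (0 + 1) c := fun _ => rfl
  refine ⟨?_, ?_, ?_, fun l hl => ?_, fun l hl => ?_, fun l m hl hm => ?_, fun l hl => ?_⟩
  · apply linearMap_ext_zero_succ <;>
      simp [omega1_single_zero, omega1_single_succ, omega2_single_zero, omega2_single_succ]
  · apply linearMap_ext_zero_succ
    · simp only [LinearMap.sub_apply, LinearMap.neg_apply, LinearMap.comp_apply,
        gammaMap_single_zero, omega1_single_zero]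
      rw [one_eq, omega1_single_succ]
      simp
    · simp [omega1_single_succ, gammaMap_single_succ]
  · apply linearMap_ext_zero_succ
    · simp only [LinearMap.sub_apply, LinearMap.comp_apply,
        gammaMap_single_zero, omega2_single_zero]
      rw [one_eq, omega2_single_succ]
      simp
    · simp [omega2_single_succ, gammaMap_single_succ]
  · lift l to ℕ using by omega
    apply linearMap_ext_zero_succ
    · simp [omega1_single_zero, alphaMap_single_zero]
    · intro n
      simp [omega1_single_succ, alphaMap_natCast_single_succ]
  · lift l to ℕ using by omega
    apply linearMap_ext_zero_succ <;>
      simp [omega2_single_zero, omega2_single_succ, alphaMap_single_zero,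
        alphaMap_natCast_single_succ]
  · lift l to ℕ using by omega
    lift m to ℕ using by omega
    apply linearMap_ext_zero_succ
    · simp [alphaMap_single_zero]
    · intro n
      simp [alphaMap_natCast_single_succ, Nat.add_right_comm n m l]
  · obtain ⟨k, rfl⟩ : ∃ k : ℕ, l = (k + 1 : ℕ) := ⟨(l - 1).toNat, by omega⟩
    rw [Int.toNat_natCast]
    apply linearMap_ext_zero_succ
    · simp only [LinearMap.sub_apply, LinearMap.neg_apply, LinearMap.comp_apply,
        gammaMap_single_zero, alphaMap_single_zero, adE_succ_single_zero]
      rw [one_eq, alphaMap_natCast_single_succ]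
      simp
    · intro n
      simp only [LinearMap.sub_apply, LinearMap.neg_apply, LinearMap.comp_apply,
        gammaMap_single_succ, alphaMap_natCast_single_succ, adE_succ_single_succ]
      simp
end

section
/- Let S be the K-vector space of admissible functions a : ℤ × ℤ → K satisfying the cocycle recurrence. Then the K-linear map from S to the space of all sequences (c_k)_{k≥1} in K, sending a to the sequence (a(2,2k+1))_{k≥1}, is bijective. In particular, S is an infinite-dimensional K-vector space. -/
/-- `a : ℤ × ℤ → K` (curried) is admissible: antisymmetric, and vanishing whenever
one of the indices is `≤ 1`. -/
def IsAdmissible {K : Type*} [Field K] (a : ℤ → ℤ → K) : Prop :=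
  (∀ i j : ℤ, a j i = -a i j) ∧ (∀ i j : ℤ, i ≤ 1 ∨ j ≤ 1 → a i j = 0)

/-- `a` satisfies the cocycle recurrence `a (i+1) j + a i (j+1) = a i j` for `i, j ≥ 2`. -/
def CocycleRec {K : Type*} [Field K] (a : ℤ → ℤ → K) : Prop :=
  ∀ i j : ℤ, 2 ≤ i → 2 ≤ j → a (i + 1) j + a i (j + 1) = a i j

/-- The weight-`l` Massey square of `a`. -/
def MasseySq {K : Type*} [Field K] (l : ℤ) (a : ℤ → ℤ → K) (i j k : ℤ) : K :=
  a i j * a (i + j + l) k + a j k * a (j + k + l) i + a k i * a (k + i + l) j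

/-- Auxiliary for the `m`-family: its values on pairs `(i,j)` with `2 ≤ i < j`. -/
def famAux (K : Type*) [Field K] (m i j : ℤ) : K :=
  if 2 ≤ i ∧ i < j ∧ i ≤ m ∧ m + 1 ≤ j then
    (-1 : K) ^ (m - i).toNat * ((j - m - 1).toNat.choose (m - i).toNat : K)
  else 0

/-- The `m`-family `F_m`: for `2 ≤ i < j`, `F_m(i,j) = (-1)^(m-i) * C(j-m-1, m-i)` if
`i ≤ m` and `j ≥ m+1`, and `0` otherwise; extended antisymmetrically, and `0` when an
index is `≤ 1`. -/
def Fam (K : Type*) [Field K] (m i j : ℤ) : K := famAux K m i j - famAux K m j i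

open Polynomial in
/-- The sequence of polynomials `(X (1 - X)) ^ k` in degree `2 k` and `X ^ (2 k + 1)` in degree
`2 k + 1`. -/
noncomputable def symmOddSequence (K : Type*) [Field K] : Polynomial.Sequence K where
  elems' n := if Even n then (X * (1 - X)) ^ (n / 2) else X ^ n
  degree_eq' n := by
    have h1 : (1 - X : K[X]).degree = 1 := by
      rw [← neg_sub, degree_neg, ← C_1, degree_X_sub_C]
    split_ifs with h
    · obtain ⟨k, rfl⟩ := h
      rw [degree_pow, degree_mul, degree_X, h1, show (k + k) / 2 = k by omega, nsmul_eq_mul,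
        mul_add, mul_one]
      rfl
    · exact degree_X_pow n

open Polynomial in
theorem symmOddSequence_two_mul {K : Type*} [Field K] (k : ℕ) :
    symmOddSequence K (2 * k) = (X * (1 - X)) ^ k := by
  change (if Even (2 * k) then (X * (1 - X)) ^ (2 * k / 2) else X ^ (2 * k) : K[X]) = _
  rw [if_pos (even_two_mul k), Nat.mul_div_cancel_left k two_pos]

open Polynomial in
theorem symmOddSequence_two_mul_add_one {K : Type*} [Field K] (k : ℕ) :
    symmOddSequence K (2 * k + 1) = X ^ (2 * k + 1) := by
  change (if Even (2 * k + 1) then (X * (1 - X)) ^ ((2 * k + 1) / 2) else X ^ (2 * k + 1) : K[X])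
    = _
  rw [if_neg (Nat.not_even_two_mul_add_one k)]

theorem isUnit_leadingCoeff_symmOddSequence {K : Type*} [Field K] (n : ℕ) :
    IsUnit (symmOddSequence K n).leadingCoeff :=
  (Polynomial.leadingCoeff_ne_zero.2 ((symmOddSequence K).ne_zero n)).isUnit

open Polynomial in
/-- A linear functional on polynomials is determined by its values on `(X (1 - X)) ^ k` and
`X ^ (2 k + 1)`. -/
theorem linearMap_ext_symm_odd {K : Type*} [Field K] {L M : K[X] →ₗ[K] K}
    (heven : ∀ k : ℕ, L ((X * (1 - X)) ^ k) = M ((X * (1 - X)) ^ k))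
    (hodd : ∀ k : ℕ, L (X ^ (2 * k + 1)) = M (X ^ (2 * k + 1))) : L = M := by
  refine ((symmOddSequence K).basis isUnit_leadingCoeff_symmOddSequence).ext fun n => ?_
  rw [Polynomial.Sequence.basis_eq_self]
  obtain ⟨k, rfl | rfl⟩ := n.even_or_odd'
  · rw [symmOddSequence_two_mul, heven]
  · rw [symmOddSequence_two_mul_add_one, hodd]

open Polynomial in
theorem exists_linearMap_symm_odd {K : Type*} [Field K] (c : ℕ → K) :
    ∃ L : K[X] →ₗ[K] K, (∀ k : ℕ, L ((X * (1 - X)) ^ k) = 0) ∧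
      ∀ k : ℕ, L (X ^ (2 * k + 1)) = c k := by
  let B := (symmOddSequence K).basis isUnit_leadingCoeff_symmOddSequence
  have hB (n : ℕ) : B n = symmOddSequence K n := Polynomial.Sequence.basis_eq_self _ _ n
  refine ⟨B.constr K fun n => if Even n then 0 else c (n / 2), fun k => ?_, fun k => ?_⟩
  · rw [← symmOddSequence_two_mul, ← hB, Module.Basis.constr_basis, if_pos (even_two_mul k)]
  · rw [← symmOddSequence_two_mul_add_one, ← hB, Module.Basis.constr_basis,
      if_neg (Nat.not_even_two_mul_add_one k), show (2 * k + 1) / 2 = k by omega]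

/-- A symmetric array satisfying the recurrence and vanishing on the diagonal is zero. -/
theorem eq_zero_of_symm_of_diag_eq_zero {K : Type*} [Field K] [CharZero K] {d : ℕ → ℕ → K}
    (hsymm : ∀ i j, d i j = d j i) (hrec : ∀ i j, d (i + 1) j + d i (j + 1) = d i j)
    (hdiag : ∀ i, d i i = 0) (i j : ℕ) : d i j = 0 := by
  have key (k : ℕ) : ∀ i, d i (i + k) = 0 := by
    induction k using Nat.strong_induction_on with
    | _ k ih =>
      intro i
      match k with
      | 0 => exact hdiag i
      | 1 =>
        have h := hrec i i
        rw [hdiag, hsymm (i + 1) i, ← two_mul] at h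
        exact (mul_eq_zero.1 h).resolve_left two_ne_zero
      | k + 2 =>
        have h := hrec i (i + (k + 1))
        rw [ih (k + 1) (by omega) i, show i + (k + 1) = i + 1 + k by ring,
          ih k (by omega) (i + 1), zero_add] at h
        rw [← h]
        congr 1
        ring
  obtain h | h := le_total i j
  · obtain ⟨k, rfl⟩ := Nat.exists_eq_add_of_le h
    exact key k i
  · obtain ⟨k, rfl⟩ := Nat.exists_eq_add_of_le h
    rw [hsymm]
    exact key k j

open Polynomial in
theorem linearMap_one_sub_X_pow_mul_X_pow_rec {K : Type*} [Field K] (L : K[X] →ₗ[K] K)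
    (i j : ℕ) :
    L ((1 - X) ^ (i + 1) * X ^ j) + L ((1 - X) ^ i * X ^ (j + 1)) = L ((1 - X) ^ i * X ^ j) := by
  rw [← map_add]
  congr 1
  ring

open Polynomial in
theorem linearMap_one_sub_X_pow_mul_X_pow_antisymm {K : Type*} [Field K] [CharZero K]
    {L : K[X] →ₗ[K] K} (hL : ∀ k : ℕ, L ((X * (1 - X)) ^ k) = 0) (i j : ℕ) :
    L ((1 - X) ^ j * X ^ i) = -L ((1 - X) ^ i * X ^ j) := by
  rw [eq_neg_iff_add_eq_zero]
  refine eq_zero_of_symm_of_diag_eq_zero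
    (d := fun i j => L ((1 - X) ^ j * X ^ i) + L ((1 - X) ^ i * X ^ j))
    (fun i j => add_comm _ _) (fun i j => ?_) (fun i => ?_) i j
  · rw [← linearMap_one_sub_X_pow_mul_X_pow_rec L i j,
      ← linearMap_one_sub_X_pow_mul_X_pow_rec L j i]
    ring
  · rw [← mul_pow, mul_comm (1 - X), hL, add_zero]

open Polynomial in
/-- Every solution of the recurrence is the moment array of a linear functional. -/
theorem CocycleRec.exists_linearMap {K : Type*} [Field K] {a : ℤ → ℤ → K} (ha : CocycleRec a) :
    ∃ L : K[X] →ₗ[K] K, ∀ i j : ℕ, L ((1 - X) ^ i * X ^ j) = a (i + 2) (j + 2) := by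
  let L : K[X] →ₗ[K] K := (basisMonomials K).constr K fun n : ℕ => a 2 (n + 2)
  have hL (n : ℕ) : L (X ^ n) = a 2 (n + 2) := by
    have h : basisMonomials K n = X ^ n := by rw [coe_basisMonomials, X_pow_eq_monomial]
    rw [← h]
    exact (basisMonomials K).constr_basis K _ n
  refine ⟨L, fun i => ?_⟩
  induction i with
  | zero => intro j; simpa using hL j
  | succ i ih =>
    intro j
    have h := linearMap_one_sub_X_pow_mul_X_pow_rec L i j
    have h' := ha (i + 2) (j + 2) (by omega) (by omega)
    rw [ih, ih, ← h'] at h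
    push_cast at h ⊢
    rw [show (j : ℤ) + 1 + 2 = j + 2 + 1 by ring] at h
    rw [show (i : ℤ) + 1 + 2 = i + 2 + 1 by ring]
    exact add_right_cancel h

open Polynomial in
/-- The admissible array attached to a linear functional on polynomials. -/
noncomputable def momentArray {K : Type*} [Field K] (L : K[X] →ₗ[K] K) (i j : ℤ) : K :=
  if i ≤ 1 ∨ j ≤ 1 then 0 else L ((1 - X) ^ (i - 2).toNat * X ^ (j - 2).toNat)

open Polynomial in
theorem momentArray_natCast_add_two {K : Type*} [Field K] (L : K[X] →ₗ[K] K) (i j : ℕ) :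
    momentArray L (i + 2) (j + 2) = L ((1 - X) ^ i * X ^ j) := by
  rw [momentArray, if_neg (by omega)]
  simp

open Polynomial in
theorem isAdmissible_momentArray {K : Type*} [Field K] [CharZero K] {L : K[X] →ₗ[K] K}
    (hL : ∀ k : ℕ, L ((X * (1 - X)) ^ k) = 0) : IsAdmissible (momentArray L) := by
  refine ⟨fun i j => ?_, fun i j h => if_pos h⟩
  by_cases h : i ≤ 1 ∨ j ≤ 1
  · rw [momentArray, momentArray, if_pos h, if_pos h.symm, neg_zero]
  · rw [momentArray, momentArray, if_neg h, if_neg (h ∘ Or.symm)]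
    exact linearMap_one_sub_X_pow_mul_X_pow_antisymm hL _ _

theorem exists_natCast_add_two {i : ℤ} (hi : 2 ≤ i) : ∃ n : ℕ, i = n + 2 :=
  ⟨(i - 2).toNat, by omega⟩

open Polynomial in
theorem cocycleRec_momentArray {K : Type*} [Field K] (L : K[X] →ₗ[K] K) :
    CocycleRec (momentArray L) := by
  intro i j hi hj
  obtain ⟨m, rfl⟩ := exists_natCast_add_two hi
  obtain ⟨n, rfl⟩ := exists_natCast_add_two hj
  rw [show (m : ℤ) + 2 + 1 = (m + 1 : ℕ) + 2 by push_cast; ring,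
    show (n : ℤ) + 2 + 1 = (n + 1 : ℕ) + 2 by push_cast; ring]
  simp only [momentArray_natCast_add_two]
  exact linearMap_one_sub_X_pow_mul_X_pow_rec L m n

/-- The map sending an admissible solution `a` of the cocycle recurrence to the sequence
`(a 2 (2k+1))_{k ≥ 1}` is bijective: every sequence has a unique preimage. In particular
the space of such `a` is an infinite-dimensional `K`-vector space. -/
theorem cocycle_space_bijects_to_sequences (K : Type*) [Field K] [CharZero K] :
    ∀ c : ℕ → K, ∃! a : ℤ → ℤ → K,
      (IsAdmissible a ∧ CocycleRec a) ∧
      ∀ k : ℕ, 1 ≤ k → a 2 (2 * (k : ℤ) + 1) = c k := by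
  intro c
  obtain ⟨L, heven, hodd⟩ := exists_linearMap_symm_odd fun k => c (k + 1)
  refine ⟨momentArray L, ⟨⟨isAdmissible_momentArray heven, cocycleRec_momentArray L⟩,
    fun k hk => ?_⟩, ?_⟩
  · obtain ⟨k, rfl⟩ := Nat.exists_eq_add_of_le' hk
    have h := momentArray_natCast_add_two L 0 (2 * k + 1)
    rw [pow_zero, one_mul, hodd] at h
    rw [← h]
    congr 1
  · rintro a ⟨⟨⟨hanti, hvan⟩, hrec⟩, hc⟩
    obtain ⟨M, hM⟩ := hrec.exists_linearMap
    have hML : M = L := by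
      refine linearMap_ext_symm_odd (fun k => ?_) (fun k => ?_)
      · rw [heven, mul_comm, mul_pow, hM]
        exact self_eq_neg.1 (hanti _ _)
      · have h := hM 0 (2 * k + 1)
        rw [pow_zero, one_mul] at h
        rw [hodd, h, ← hc (k + 1) (by omega)]
        congr 1
    subst hML
    ext i j
    by_cases h : i ≤ 1 ∨ j ≤ 1
    · rw [hvan i j h, momentArray, if_pos h]
    · obtain ⟨m, rfl⟩ := exists_natCast_add_two (show 2 ≤ i by omega)
      obtain ⟨n, rfl⟩ := exists_natCast_add_two (show 2 ≤ j by omega)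
      rw [momentArray_natCast_add_two, hM]
end

section
/- For every integer m ≥ 2 and all integers i,j ≥ 2, the m-family satisfies F_m(i+1,j) + F_m(i,j+1) = F_m(i,j); hence the m-family defines a homogeneous 2-cocycle of 𝔪₀ in any weight. -/
theorem famAux_eq_zero {K : Type*} [Field K] {m i j : ℤ} (h : m < i ∨ j ≤ m) :
    famAux K m i j = 0 :=
  if_neg (by omega)

theorem famAux_sub_add {K : Type*} [Field K] {m : ℤ} {r s : ℕ} (h : 2 ≤ m - r) :
    famAux K m (m - r) (m + 1 + s) = (-1) ^ r * (s.choose r : K) := by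
  rw [famAux, if_pos (by omega), show (m - (m - r)).toNat = r by omega,
    show (m + 1 + s - m - 1).toNat = s by omega]

/-- `famAux` satisfies the cocycle recurrence except at `(m, m)`, where the defect is `1`. -/
theorem famAux_recurrence (K : Type*) [Field K] {m i j : ℤ} (hi : 2 ≤ i) :
    famAux K m (i + 1) j + famAux K m i (j + 1) =
      famAux K m i j + if i = m ∧ j = m then 1 else 0 := by
  rcases lt_or_ge m i with him | him
  · rw [famAux_eq_zero, famAux_eq_zero, famAux_eq_zero, if_neg, add_zero] <;> omega
  obtain ⟨r, rfl⟩ : ∃ r : ℕ, i = m - r := ⟨(m - i).toNat, by omega⟩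
  rcases lt_trichotomy j m with hj | rfl | hj
  · rw [famAux_eq_zero, famAux_eq_zero, famAux_eq_zero, if_neg, add_zero] <;> omega
  · have h := famAux_sub_add (K := K) (s := 0) hi
    rw [Nat.cast_zero, add_zero] at h
    rw [famAux_eq_zero (Or.inr le_rfl), famAux_eq_zero (Or.inr le_rfl), h]
    cases r with
    | zero => simp
    | succ r => rw [if_neg (by omega)]; simp
  · obtain ⟨s, rfl⟩ : ∃ s : ℕ, j = m + 1 + s := ⟨(j - m - 1).toNat, by omega⟩
    have h := famAux_sub_add (K := K) (s := s + 1) hi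
    rw [Nat.cast_succ, ← add_assoc] at h
    rw [h, famAux_sub_add hi, if_neg (by omega)]
    cases r with
    | zero => rw [famAux_eq_zero (Or.inl (by simp))]; simp
    | succ r =>
      rw [show m - ((r + 1 : ℕ) : ℤ) + 1 = m - r by omega, famAux_sub_add (r := r) (by omega),
        Nat.choose_succ_succ]
      push_cast
      ring

/-- For every `m ≥ 2`, the `m`-family satisfies the cocycle recurrence
`F_m(i+1,j) + F_m(i,j+1) = F_m(i,j)` for all `i, j ≥ 2`; hence it defines a
homogeneous 2-cocycle of `𝔪₀` in any weight. -/
theorem fam_satisfies_cocycle_recurrence (K : Type*) [Field K] [CharZero K] :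
    ∀ m : ℤ, 2 ≤ m → ∀ i j : ℤ, 2 ≤ i → 2 ≤ j →
      Fam K m (i + 1) j + Fam K m i (j + 1) = Fam K m i j := by
  intro m _ i j hi hj
  have h₁ := famAux_recurrence K (m := m) (j := j) hi
  have h₂ := famAux_recurrence K (m := m) (j := i) hj
  simp only [and_comm (a := j = m)] at h₂
  unfold Fam
  linear_combination h₁ - h₂
end

section
/- For every integer m ≥ 2, all Massey squares of weight −m of the m-family vanish: M_{−m}(F_m)(i,j,k) = 0 for all integers i,j,k, that is, F_m(i,j)·F_m(i+j−m,k) + F_m(j,k)·F_m(j+k−m,i) + F_m(k,i)·F_m(k+i−m,j) = 0. -/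
lemma fam_swap (K : Type*) [Field K] (m i j : ℤ) : Fam K m j i = -Fam K m i j := by
  simp [Fam]

lemma fam_of_low_of_high (K : Type*) [Field K] {m i j : ℤ} (hi : 2 ≤ i ∧ i ≤ m) (hj : m < j) :
    Fam K m i j =
      (-1 : K) ^ (m - i).toNat * ((j - m - 1).toNat.choose (m - i).toNat : K) := by
  rw [Fam, famAux, famAux, if_pos (by omega), if_neg (by omega), sub_zero]

lemma fam_eq_zero (K : Type*) [Field K] {m i j : ℤ} (h : ¬((2 ≤ i ∧ i ≤ m) ∧ m < j))
    (h' : ¬((2 ≤ j ∧ j ≤ m) ∧ m < i)) : Fam K m i j = 0 := by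
  rw [Fam, famAux, famAux, if_neg (by omega), if_neg (by omega), sub_zero]

/-- A nonzero value `F_m(i,j)` at `i ≤ m < j` forces `i + j - m > m`. -/
lemma fam_eq_zero_of_add_le (K : Type*) [Field K] {m i j : ℤ} (hi : 2 ≤ i ∧ i ≤ m) (hj : m < j)
    (h : i + j + -m ≤ m) : Fam K m i j = 0 := by
  rw [fam_of_low_of_high K hi hj, Nat.choose_eq_zero_of_lt (by omega), Nat.cast_zero, mul_zero]

lemma choose_mul_choose_sub_comm (q p r : ℕ) :
    q.choose p * (q - p).choose r = q.choose r * (q - r).choose p := by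
  rcases le_or_gt (p + r) q with h | h
  · have hp := Nat.choose_mul (n := q) (k := p + r) (s := p) (by omega)
    have hr := Nat.choose_mul (n := q) (k := p + r) (s := r) (by omega)
    rw [Nat.add_sub_cancel_left] at hp
    rw [Nat.add_sub_cancel] at hr
    rw [← hp, ← hr, Nat.choose_symm_add]
  · have hzero : ∀ a b : ℕ, q < a + b → q.choose a * (q - a).choose b = 0 := fun a b hab ↦ by
      rw [mul_eq_zero, Nat.choose_eq_zero_iff, Nat.choose_eq_zero_iff]
      omega
    rw [hzero p r h, hzero r p (by omega)]

lemma fam_mul_fam_eq_zero (K : Type*) [Field K] {m i j k : ℤ}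
    (h : ¬((2 ≤ i ∧ i ≤ m) ∧ m < j ∧ 2 ≤ k ∧ k ≤ m))
    (h' : ¬((2 ≤ j ∧ j ≤ m) ∧ m < i ∧ 2 ≤ k ∧ k ≤ m)) :
    Fam K m i j * Fam K m (i + j + -m) k = 0 := by
  by_cases hij : (2 ≤ i ∧ i ≤ m) ∧ m < j
  · rcases le_or_gt (i + j + -m) m with hs | hs
    · rw [fam_eq_zero_of_add_le K hij.1 hij.2 hs, zero_mul]
    · rw [fam_eq_zero K (i := i + j + -m) (by omega) (by omega), mul_zero]
  by_cases hji : (2 ≤ j ∧ j ≤ m) ∧ m < i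
  · rcases le_or_gt (i + j + -m) m with hs | hs
    · rw [fam_swap, fam_eq_zero_of_add_le K hji.1 hji.2 (by omega), neg_zero, zero_mul]
    · rw [fam_eq_zero K (i := i + j + -m) (by omega) (by omega), mul_zero]
  · rw [fam_eq_zero K hij hji, zero_mul]

lemma fam_mul_fam_of_low_high_low (K : Type*) [Field K] {m i j k : ℤ} (hi : 2 ≤ i ∧ i ≤ m)
    (hj : m < j) (hk : 2 ≤ k ∧ k ≤ m) :
    Fam K m i j * Fam K m (i + j + -m) k =
      -((-1 : K) ^ (m - i).toNat * (-1) ^ (m - k).toNat *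
        (((j - m - 1).toNat.choose (m - i).toNat *
          ((j - m - 1).toNat - (m - i).toNat).choose (m - k).toNat : ℕ) : K)) := by
  rcases le_or_gt (i + j + -m) m with hs | hs
  · rw [fam_eq_zero_of_add_le K hi hj hs,
      Nat.choose_eq_zero_of_lt (n := (j - m - 1).toNat) (k := (m - i).toNat) (by omega)]
    simp
  · rw [fam_swap K m k, fam_of_low_of_high K hi hj, fam_of_low_of_high K hk hs,
      show (i + j + -m - m - 1).toNat = (j - m - 1).toNat - (m - i).toNat by omega]
    push_cast
    ring

/-- The nonzero terms of the Massey square cancel in pairs. -/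
lemma fam_mul_fam_add_of_low_high_low (K : Type*) [Field K] {m i j k : ℤ}
    (hi : 2 ≤ i ∧ i ≤ m) (hj : m < j) (hk : 2 ≤ k ∧ k ≤ m) :
    Fam K m i j * Fam K m (i + j + -m) k + Fam K m j k * Fam K m (j + k + -m) i = 0 := by
  rw [fam_swap K m k j, add_comm j k, neg_mul, fam_mul_fam_of_low_high_low K hi hj hk,
    fam_mul_fam_of_low_high_low K hk hj hi, choose_mul_choose_sub_comm]
  ring

/-- For every `m ≥ 2`, all weight-`(-m)` Massey squares of the `m`-family vanish:
`F_m(i,j)·F_m(i+j-m,k) + F_m(j,k)·F_m(j+k-m,i) + F_m(k,i)·F_m(k+i-m,j) = 0`. -/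
theorem fam_massey_squares_vanish (K : Type*) [Field K] [CharZero K] :
    ∀ m : ℤ, 2 ≤ m → ∀ i j k : ℤ,
      MasseySq (-m) (Fam K m) i j k = 0 := by
  intro m _ i j k
  rw [MasseySq]
  by_cases hj : (2 ≤ i ∧ i ≤ m) ∧ m < j ∧ 2 ≤ k ∧ k ≤ m
  · rw [fam_mul_fam_add_of_low_high_low K hj.1 hj.2.1 hj.2.2,
      fam_mul_fam_eq_zero K (by omega) (by omega), add_zero]
  by_cases hk : (2 ≤ j ∧ j ≤ m) ∧ m < k ∧ 2 ≤ i ∧ i ≤ m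
  · rw [add_assoc, fam_mul_fam_add_of_low_high_low K hk.1 hk.2.1 hk.2.2,
      fam_mul_fam_eq_zero K (by omega) (by omega), add_zero]
  by_cases hi : (2 ≤ k ∧ k ≤ m) ∧ m < i ∧ 2 ≤ j ∧ j ≤ m
  · rw [add_right_comm, add_comm (Fam K m i j * _),
      fam_mul_fam_add_of_low_high_low K hi.1 hi.2.1 hi.2.2,
      fam_mul_fam_eq_zero K (by omega) (by omega), add_zero]
  · rw [fam_mul_fam_eq_zero K (by omega) (by omega), fam_mul_fam_eq_zero K (by omega) (by omega),
      fam_mul_fam_eq_zero K (by omega) (by omega), add_zero, add_zero]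
end

section
/- Let l ≥ 0 be an integer and let a : ℤ × ℤ → K be admissible and satisfy the cocycle recurrence. Then for all integers i,k ≥ 2 and j ≥ 3, the weight-l Massey squares satisfy the relation M_l(a)(i,j,k) + M_l(a)(i,j−1,k+1) + M_l(a)(i+1,j−1,k) = M_l(a)(i,j−1,k). -/
/-- Relation among Massey squares: for `l ≥ 0` and `a` admissible satisfying the cocycle
recurrence, `M(i,j,k) + M(i,j-1,k+1) + M(i+1,j-1,k) = M(i,j-1,k)` for all `i,k ≥ 2`,
`j ≥ 3`. -/
theorem massey_square_relation (K : Type*) [Field K] [CharZero K] :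
    ∀ l : ℤ, 0 ≤ l → ∀ a : ℤ → ℤ → K, IsAdmissible a → CocycleRec a →
      ∀ i j k : ℤ, 2 ≤ i → 2 ≤ k → 3 ≤ j →
        MasseySq l a i j k + MasseySq l a i (j - 1) (k + 1) +
          MasseySq l a (i + 1) (j - 1) k = MasseySq l a i (j - 1) k := by
  intro l hl a _ hrec i j k hi hk hj
  obtain ⟨p, rfl⟩ : ∃ p, j = p + 1 := ⟨j - 1, by ring⟩
  have hp : 2 ≤ p := by lia
  have h₁ := hrec i p hi hp
  have h₂ := hrec p k hp hk
  have h₃ := hrec k i hk hi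
  have g₁ := hrec (i + p + l) k (by lia) hk
  have g₂ := hrec (p + k + l) i (by lia) hi
  have g₃ := hrec (k + i + l) p (by lia) hp
  simp only [MasseySq, add_sub_cancel_right]
  rw [show i + (p + 1) + l = i + p + l + 1 by ring,
    show p + 1 + k + l = p + k + l + 1 by ring,
    show p + (k + 1) + l = p + k + l + 1 by ring,
    show k + 1 + i + l = k + i + l + 1 by ring,
    show i + 1 + p + l = i + p + l + 1 by ring,
    show k + (i + 1) + l = k + i + l + 1 by ring]
  linear_combination a (i + p + l + 1) k * h₁ + a (p + k + l + 1) i * h₂ +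
    a (k + i + l + 1) p * h₃ + a i p * g₁ + a p k * g₂ + a k i * g₃
end

section
/- Let a : ℤ × ℤ → K be admissible, satisfy the cocycle recurrence, and suppose that every Massey square of weight −1 vanishes: M_{−1}(a)(i,j,k) = 0 for all integers i,j,k. Then a is a scalar multiple of the 2-family: there exists c ∈ K with a(2,j) = c for all j ≥ 3 and a(i,j) = 0 whenever 3 ≤ i < j. (In particular, since the 2-family is a coboundary in weight −1, there is no non-trivial square-zero cohomology class, and hence no true deformation of 𝔪₀, in weight −1.) -/
section AntidiagonalVanishing

variable {K : Type*} [Field K] {a : ℤ → ℤ → K}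

/-- If `a` vanishes on the indices `≥ 3` with sum at most `2n + 6`, then `a 2` is constant
on `3, …, 2n + 4`. -/
theorem CocycleRec.apply_two_eq (hrec : CocycleRec a) {n : ℕ}
    (h0 : ∀ i j : ℤ, 3 ≤ i → 3 ≤ j → i + j ≤ 2 * n + 6 → a i j = 0) (m : ℕ)
    (hm : m ≤ 2 * n + 1) : a 2 (3 + m) = a 2 3 := by
  induction m with
  | zero => simp
  | succ m ih =>
    have h1 := hrec 2 (3 + m) le_rfl (by lia)
    rw [show (2 : ℤ) + 1 = 3 by norm_num, h0 3 (3 + m) le_rfl (by lia) (by lia),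
      ih (by lia), zero_add] at h1
    rw [← h1]
    push_cast
    ring_nf

/-- The first odd antidiagonal past the vanishing range alternates in sign. -/
theorem CocycleRec.odd_antidiagonal (hrec : CocycleRec a) {n : ℕ}
    (h0 : ∀ i j : ℤ, 3 ≤ i → 3 ≤ j → i + j ≤ 2 * n + 6 → a i j = 0) (t : ℕ) (ht : t ≤ n) :
    a (n + 3 - t) (n + 4 + t) = (-1) ^ t * a (n + 3) (n + 4) := by
  induction t with
  | zero => simp
  | succ t ih =>
    have h1 := hrec (n + 3 - (t + 1)) (n + 4 + t) (by lia) (by lia)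
    rw [h0 (n + 3 - (t + 1)) (n + 4 + t) (by lia) (by lia) (by lia),
      show (n : ℤ) + 3 - (t + 1) + 1 = n + 3 - t by ring, ih (by lia)] at h1
    push_cast
    rw [← add_assoc]
    linear_combination h1

variable [CharZero K]

theorem IsAdmissible.apply_self (ha : IsAdmissible a) (i : ℤ) : a i i = 0 :=
  self_eq_neg.mp (ha.1 i i)

/-- The values of `a` on the first even antidiagonal past the vanishing range. -/
theorem CocycleRec.even_antidiagonal (ha : IsAdmissible a) (hrec : CocycleRec a) {n : ℕ}
    (h0 : ∀ i j : ℤ, 3 ≤ i → 3 ≤ j → i + j ≤ 2 * n + 6 → a i j = 0) (t : ℕ)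
    (ht : t ≤ n + 1) :
    a (n + 4 - t) (n + 4 + t) = (-1) ^ (t + 1) * t * a (n + 3) (n + 4) := by
  induction t with
  | zero => simp [ha.apply_self]
  | succ t ih =>
    have h1 := hrec (n + 3 - t) (n + 4 + t) (by lia) (by lia)
    rw [hrec.odd_antidiagonal h0 t (by lia),
      show (n : ℤ) + 3 - t + 1 = n + 4 - t by ring, ih (by lia)] at h1
    push_cast
    rw [show (n : ℤ) + 4 - (t + 1) = n + 3 - t by ring, ← add_assoc]
    linear_combination h1

/-- The Massey square at `(2, r, r + 1)` with `r = n + 3` equals `± (r - 1) * a r (r + 1) ^ 2`. -/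
theorem apply_middle_eq_zero (ha : IsAdmissible a) (hrec : CocycleRec a) {n : ℕ}
    (hM : MasseySq (-1) a 2 (n + 3) (n + 4) = 0)
    (h0 : ∀ i j : ℤ, 3 ≤ i → 3 ≤ j → i + j ≤ 2 * n + 6 → a i j = 0) :
    a (n + 3) (n + 4) = 0 := by
  have hx := hrec.odd_antidiagonal h0 n le_rfl
  have hy := hrec.even_antidiagonal ha h0 (n + 1) le_rfl
  have hy1 := hrec.even_antidiagonal ha h0 1 (by lia)
  have hc := hrec.apply_two_eq h0 (n + 1) (by lia)
  have hc' := hrec.apply_two_eq h0 (2 * n + 1) le_rfl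
  have r1 := hrec 2 (2 * n + 4) le_rfl (by lia)
  have r2 := hrec 2 (2 * n + 5) le_rfl (by lia)
  unfold MasseySq at hM
  rw [show (2 : ℤ) + (n + 3) + -1 = n + 4 by ring, ha.apply_self,
    show (n : ℤ) + 3 + (n + 4) + -1 = 2 * n + 6 by ring,
    show (n : ℤ) + 4 + 2 + -1 = n + 5 by ring, ha.1 2 (2 * n + 6), ha.1 2 (n + 4),
    ha.1 (n + 3) (n + 5)] at hM
  rw [show (n : ℤ) + 3 - n = 3 by ring, show (n : ℤ) + 4 + n = 2 * n + 4 by ring] at hx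
  push_cast at hy hy1 hc hc'
  rw [show (n : ℤ) + 4 - (n + 1) = 3 by ring,
    show (n : ℤ) + 4 + (n + 1) = 2 * n + 5 by ring] at hy
  rw [show (n : ℤ) + 4 - 1 = n + 3 by ring, show (n : ℤ) + 4 + 1 = n + 5 by ring] at hy1
  rw [show (3 : ℤ) + (n + 1) = n + 4 by ring] at hc
  rw [show (3 : ℤ) + (2 * n + 1) = 2 * n + 4 by ring] at hc'
  rw [show (2 : ℤ) + 1 = 3 by norm_num, hx, hc',
    show (2 : ℤ) * n + 4 + 1 = 2 * n + 5 by ring] at r1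
  rw [show (2 : ℤ) + 1 = 3 by norm_num, hy,
    show (2 : ℤ) * n + 5 + 1 = 2 * n + 6 by ring] at r2
  rw [hy1, hc] at hM
  set x := a (n + 3) (n + 4)
  have key : (-1 : K) ^ n * (n + 2 : ℕ) * (x * x) = 0 := by
    push_cast
    linear_combination hM + x * (r1 + r2)
  have hne : (-1 : K) ^ n * (n + 2 : ℕ) ≠ 0 :=
    mul_ne_zero (pow_ne_zero _ (by norm_num)) (Nat.cast_ne_zero.mpr (by lia))
  exact mul_self_eq_zero.mp ((mul_eq_zero.mp key).resolve_left hne)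

theorem apply_eq_zero_of_add_le (ha : IsAdmissible a) (hrec : CocycleRec a)
    (hM : ∀ i j k : ℤ, MasseySq (-1) a i j k = 0) (n : ℕ) :
    ∀ i j : ℤ, 3 ≤ i → 3 ≤ j → i + j ≤ 2 * n + 6 → a i j = 0 := by
  induction n with
  | zero =>
    intro i j hi hj hij
    obtain rfl : i = j := by lia
    exact ha.apply_self i
  | succ n ih =>
    have hx := apply_middle_eq_zero ha hrec (hM _ _ _) ih
    have ordered : ∀ i j : ℤ, 3 ≤ i → i ≤ j → i + j ≤ 2 * n + 8 → a i j = 0 := by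
      intro i j hi hij hs
      rcases (by lia : i + j ≤ 2 * n + 6 ∨ i + j = 2 * n + 7 ∨ i + j = 2 * n + 8)
        with h | h | h
      · exact ih i j hi (by lia) h
      · obtain ⟨t, ht⟩ := Int.eq_ofNat_of_zero_le (by lia : 0 ≤ (n : ℤ) + 3 - i)
        have h1 := hrec.odd_antidiagonal ih t (by lia)
        rwa [hx, mul_zero, show (n : ℤ) + 3 - t = i by lia,
          show (n : ℤ) + 4 + t = j by lia] at h1
      · obtain ⟨t, ht⟩ := Int.eq_ofNat_of_zero_le (by lia : 0 ≤ (n : ℤ) + 4 - i)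
        have h1 := hrec.even_antidiagonal ha ih t (by lia)
        rwa [hx, mul_zero, show (n : ℤ) + 4 - t = i by lia,
          show (n : ℤ) + 4 + t = j by lia] at h1
    intro i j hi hj hs
    push_cast at hs
    rcases le_total i j with h | h
    · exact ordered i j hi h (by lia)
    · rw [ha.1 j i, ordered j i hj h (by lia), neg_zero]

end AntidiagonalVanishing

/-- In weight `-1`, every admissible solution of the cocycle recurrence all of whose
weight-`(-1)` Massey squares vanish is a scalar multiple of the 2-family. (Since the
2-family is a coboundary in weight `-1`, there is no non-trivial square-zero cohomology
class and hence no true deformation of `𝔪₀` in weight `-1`.) -/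
theorem weight_neg_one_no_true_deformation (K : Type*) [Field K] [CharZero K]
    (a : ℤ → ℤ → K) (ha : IsAdmissible a) (hrec : CocycleRec a)
    (hM : ∀ i j k : ℤ, MasseySq (-1) a i j k = 0) :
    ∃ c : K, (∀ j : ℤ, 3 ≤ j → a 2 j = c) ∧
      (∀ i j : ℤ, 3 ≤ i → i < j → a i j = 0) := by
  have h0 := apply_eq_zero_of_add_le ha hrec hM
  refine ⟨a 2 3, fun j hj => ?_, fun i j hi hij => ?_⟩
  · obtain ⟨m, hm⟩ := Int.eq_ofNat_of_zero_le (by lia : 0 ≤ j - 3)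
    have h1 := hrec.apply_two_eq (h0 m) m (by lia)
    rwa [show (3 : ℤ) + m = j by lia] at h1
  · exact h0 (i + j).toNat i j hi (by lia) (by lia)
end

section
/- Let a : ℤ × ℤ → K be admissible, satisfy the cocycle recurrence, and suppose that M_{−2}(a)(i,j,k) = 0 for all integers 2 ≤ i < j < k with (i,j) ≠ (2,3) (these are exactly the weight −2 Massey squares that cannot be compensated by a coboundary). Then a is a linear combination of the 2-family and the 3-family: there exist s,t ∈ K such that a(2,3) = a(2,4) = s, a(2,j) = s − (j−4)t for all j ≥ 5, a(3,j) = t for all j ≥ 4, and a(i,j) = 0 whenever 4 ≤ i < j. -/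
/-- Table of values `b i j`, `2 ≤ i ≤ j`, `4 ≤ j`, obeying the cocycle recurrence, vanishing on the
diagonal and at `(2,4)`, `(3,4)`. -/
structure IsReducedCocycle {K : Type*} [Field K] (b : ℤ → ℤ → K) : Prop where
  diag : ∀ j, 4 ≤ j → b j j = 0
  two_four : b 2 4 = 0
  three_four : b 3 4 = 0
  succ_right : ∀ i j, 2 ≤ i → i ≤ j → 4 ≤ j → b i (j + 1) = b i j - b (i + 1) j

namespace IsReducedCocycle

variable {K : Type*} [Field K] {b : ℤ → ℤ → K}

/-- If the superdiagonal vanishes below `p`, all entries with `i + j ≤ 2 * p` vanish. -/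
theorem eq_zero_of_add_le (hb : IsReducedCocycle b) {p : ℤ}
    (hp : ∀ q, 4 ≤ q → q < p → b q (q + 1) = 0) {i j : ℤ} (hi : 2 ≤ i) (hij : i ≤ j) (hj : 4 ≤ j)
    (hs : i + j ≤ 2 * p) : b i j = 0 := by
  obtain ⟨d, hd⟩ : ∃ d : ℕ, j = i + d := ⟨(j - i).toNat, by omega⟩
  induction d using Nat.strong_induction_on generalizing i j with
  | _ d ih =>
    rcases eq_or_ne i j with rfl | hne
    · exact hb.diag i hj
    rcases eq_or_ne j 4 with rfl | hj4
    · obtain rfl | rfl : i = 2 ∨ i = 3 := by omega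
      · exact hb.two_four
      · exact hb.three_four
    rcases eq_or_ne j (i + 1) with rfl | hj1
    · exact hp i (by omega) (by omega)
    have h := hb.succ_right i (j - 1) hi (by omega) (by omega)
    rw [sub_add_cancel] at h
    rw [h, ih (d - 1) (by omega) hi (by omega) (by omega) (by omega) (by omega),
      ih (d - 2) (by omega) (by omega) (by omega) (by omega) (by omega) (by omega), sub_zero]

theorem apply_sub_add_one (hb : IsReducedCocycle b) {p : ℤ} (h4 : 4 ≤ p)
    (hp : ∀ q, 4 ≤ q → q < p → b q (q + 1) = 0) (r : ℕ) (hr : (r : ℤ) ≤ p - 2) :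
    b (p - r) (p + r + 1) = (-1) ^ r * b p (p + 1) := by
  induction r with
  | zero => simp
  | succ r ih =>
    push_cast at hr ⊢
    have h := hb.succ_right (p - r - 1) (p + r + 1) (by omega) (by omega) (by omega)
    rw [sub_add_cancel, ih (by omega), hb.eq_zero_of_add_le hp (i := p - r - 1) (j := p + r + 1) (by omega)
      (by omega) (by omega) (by omega)] at h
    rw [show p - ((r : ℤ) + 1) = p - r - 1 by ring,
      show p + ((r : ℤ) + 1) + 1 = p + r + 1 + 1 by ring, h]
    ring

theorem apply_sub_add_two (hb : IsReducedCocycle b) {p : ℤ} (h4 : 4 ≤ p)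
    (hp : ∀ q, 4 ≤ q → q < p → b q (q + 1) = 0) (r : ℕ) (hr : (r : ℤ) ≤ p - 2) :
    b (p - r) (p + r + 2) = (-1) ^ r * (r + 1) * b p (p + 1) := by
  induction r with
  | zero =>
    have h := hb.succ_right p (p + 1) (by omega) (by omega) (by omega)
    rw [hb.diag (p + 1) (by omega), add_assoc] at h
    simpa using h
  | succ r ih =>
    have h1 := hb.apply_sub_add_one h4 hp (r + 1) hr
    push_cast at hr h1 ⊢
    have h := hb.succ_right (p - (r + 1)) (p + r + 2) (by omega) (by omega) (by omega)
    rw [show p - ((r : ℤ) + 1) + 1 = p - r by ring, ih (by omega),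
      show p + (r : ℤ) + 2 = p + (r + 1) + 1 by ring, h1] at h
    rw [show p + ((r : ℤ) + 1) + 2 = p + (r + 1) + 1 + 1 by ring, h]
    ring

end IsReducedCocycle

/-- Classification in weight `-2`: if `a` is admissible, satisfies the cocycle
recurrence, and all non-compensable weight-`(-2)` Massey squares vanish (i.e.
`M(i,j,k) = 0` for all `2 ≤ i < j < k` with `(i,j) ≠ (2,3)`), then `a` is a linear
combination of the 2-family and the 3-family. -/
theorem weight_neg_two_classification (K : Type*) [Field K] [CharZero K]
    (a : ℤ → ℤ → K) (ha : IsAdmissible a) (hrec : CocycleRec a)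
    (hM : ∀ i j k : ℤ, 2 ≤ i → i < j → j < k → (i, j) ≠ (2, 3) →
      MasseySq (-2) a i j k = 0) :
    ∃ s t : K, a 2 3 = s ∧ a 2 4 = s ∧
      (∀ j : ℤ, 5 ≤ j → a 2 j = s - ((j - 4 : ℤ) : K) * t) ∧
      (∀ j : ℤ, 4 ≤ j → a 3 j = t) ∧
      (∀ i j : ℤ, 4 ≤ i → i < j → a i j = 0) := by
  obtain ⟨hanti, hlow⟩ := ha
  have hdiag : ∀ i, a i i = 0 := fun i => self_eq_neg.mp (hanti i i)
  have h24 : a 2 4 = a 2 3 := by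
    have h := hrec 2 3 le_rfl (by norm_num)
    norm_num [hdiag] at h
    exact h
  set s := a 2 3 with hs
  set t := a 3 4 with ht
  obtain ⟨b, hbdef⟩ : ∃ b : ℤ → ℤ → K, ∀ i j, b i j =
      a i j - (if i = 2 then s - ((j - 4 : ℤ) : K) * t else if i = 3 then t else 0) :=
    ⟨_, fun _ _ => rfl⟩
  have h2 : ∀ j, a 2 j = b 2 j + (s - ((j - 4 : ℤ) : K) * t) := fun j => by simp [hbdef]
  have h3 : ∀ j, a 3 j = b 3 j + t := fun j => by simp [hbdef]
  have hge : ∀ i j, 4 ≤ i → a i j = b i j := fun i j hi => by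
    simp [hbdef, show i ≠ 2 by omega, show i ≠ 3 by omega]
  have hb : IsReducedCocycle b := by
    refine ⟨fun j hj => ?_, ?_, ?_, fun i j hi hij hj => ?_⟩
    · rw [← hge j j hj, hdiag]
    · simp [hbdef, h24]
    · simp [hbdef, ht]
    · have h := hrec i j hi (by omega)
      rcases eq_or_ne i 2 with rfl | hi2
      · rw [show (2 : ℤ) + 1 = 3 by norm_num, h2, h2, h3] at *
        push_cast at h
        linear_combination h
      rcases eq_or_ne i 3 with rfl | hi3
      · rw [show (3 : ℤ) + 1 = 4 by norm_num, h3, h3, hge 4 j le_rfl] at *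
        linear_combination h
      · rw [hge _ _ (by omega), hge _ _ (by omega), hge _ _ (by omega)] at h
        linear_combination h
  have hfactor : ∀ j k, 4 ≤ j → j < k → a j k * (a 2 j + a 2 k - a 2 (j + k - 2)) = 0 := by
    intro j k hj hjk
    have h := hM 2 j k le_rfl (by omega) hjk (by simp; omega)
    rw [MasseySq, show 2 + j + -2 = j by ring, show k + 2 + -2 = k by ring, hanti 2 k, hanti j k,
      hanti 2 (j + k + -2), ← sub_eq_add_neg (j + k) 2] at h
    linear_combination h
  have hsuper : ∀ n : ℕ, b (n + 4) (n + 4 + 1) = 0 := by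
    intro n
    induction n using Nat.strong_induction_on with
    | _ n ih =>
      obtain ⟨p, hp⟩ : ∃ p : ℤ, p = n + 4 := ⟨_, rfl⟩
      have hlt : ∀ q, 4 ≤ q → q < p → b q (q + 1) = 0 := fun q hq hqp => by
        have h := ih (q - 4).toNat (by omega)
        rwa [show ((q - 4).toNat : ℤ) + 4 = q by omega] at h
      rw [← hp]
      by_contra hx
      have h1 := hb.apply_sub_add_one (by omega) hlt (n + 2) (by push_cast; omega)
      have h2' := hb.apply_sub_add_two (by omega) hlt (n + 2) (by push_cast; omega)
      have e0 := hb.apply_sub_add_two (by omega) hlt 0 (by push_cast; omega)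
      simp only [Nat.cast_zero, sub_zero, add_zero, pow_zero, zero_add, one_mul] at e0
      have f1 := hfactor p (p + 1) (by omega) (by omega)
      have f2 := hfactor p (p + 2) (by omega) (by omega)
      rw [hge _ _ (by omega)] at f1 f2
      have g1 := (mul_eq_zero.mp f1).resolve_left hx
      have g2 := (mul_eq_zero.mp f2).resolve_left (e0 ▸ hx)
      push_cast at h1 h2'
      rw [show p - ((n : ℤ) + 2) = 2 by omega, show p + ((n : ℤ) + 2) + 1 = p + (p + 1) - 2 by omega]
        at h1
      rw [show p - ((n : ℤ) + 2) = 2 by omega, show p + ((n : ℤ) + 2) + 2 = p + (p + 2) - 2 by omega]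
        at h2'
      have z : ∀ j, 4 ≤ j → j ≤ p + 2 → b 2 j = 0 := fun j hj hjp =>
        hb.eq_zero_of_add_le hlt le_rfl (by omega) hj (by omega)
      rw [h2, h2, h2, z p (by omega) (by omega), z (p + 1) (by omega) (by omega), h1] at g1
      rw [h2, h2, h2, z p (by omega) (by omega), z (p + 2) (by omega) (by omega), h2'] at g2
      push_cast at g1 g2
      have key : ((-1 : K) ^ (n + 2) * (n + 2 : K)) * b p (p + 1) = 0 := by
        linear_combination g1 - g2
      have hn : (n + 2 : K) ≠ 0 := by exact_mod_cast Nat.succ_ne_zero (n + 1)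
      exact (mul_ne_zero (mul_ne_zero (pow_ne_zero _ (by simp)) hn) hx) key
  have hzero : ∀ i j, 2 ≤ i → i < j → 4 ≤ j → b i j = 0 := fun i j hi hij hj =>
    hb.eq_zero_of_add_le (p := i + j) (fun q hq _ => by
      have h := hsuper (q - 4).toNat
      rwa [show ((q - 4).toNat : ℤ) + 4 = q by omega] at h) hi hij.le hj (by omega)
  refine ⟨s, t, rfl, h24, fun j hj => ?_, fun j hj => ?_, fun i j hi hij => ?_⟩
  · rw [h2, hzero 2 j le_rfl (by omega) (by omega), zero_add]
  · rw [h3, hzero 3 j (by norm_num) (by omega) (by omega), zero_add]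
  · rw [hge i j hi, hzero i j (by omega) hij (by omega)]
end

section
/- In weight 0 there are exactly two true deformations of 𝔪₀ up to scalar: an admissible function a : ℤ × ℤ → K satisfies the cocycle recurrence and M_0(a)(i,j,k) = 0 for all integers i,j,k if and only if there exists t ∈ K such that either a = t·F_2 (the 2-family, deforming 𝔪₀ to 𝔪₂), or a(i,j) = t·(j−i)·(i−2)!·(j−2)!/(i+j−2)! for all 2 ≤ i < j (the family deforming 𝔪₀ to L₁). -/
section Admissible

variable {K : Type*} [Field K]

theorem IsAdmissible.ext {a b : ℤ → ℤ → K} (ha : IsAdmissible a) (hb : IsAdmissible b)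
    (hdiag : ∀ i, a i i = b i i) (h : ∀ i j, 2 ≤ i → i < j → a i j = b i j) (i j : ℤ) :
    a i j = b i j := by
  by_cases hij : i ≤ 1 ∨ j ≤ 1
  · rw [ha.2 i j hij, hb.2 i j hij]
  push Not at hij
  rcases lt_trichotomy i j with hlt | rfl | hlt
  · exact h i j (by omega) hlt
  · exact hdiag i
  · rw [ha.1 j i, hb.1 j i, h j i (by omega) hlt]

theorem IsAdmissible.self_eq_zero [CharZero K] {a : ℤ → ℤ → K} (ha : IsAdmissible a) (i : ℤ) :
    a i i = 0 :=
  self_eq_neg.mp (ha.1 i i)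

theorem IsAdmissible.sub {a b : ℤ → ℤ → K} (ha : IsAdmissible a) (hb : IsAdmissible b) :
    IsAdmissible fun i j => a i j - b i j := by
  refine ⟨fun i j => ?_, fun i j h => ?_⟩
  · linear_combination ha.1 i j - hb.1 i j
  · simp only [ha.2 i j h, hb.2 i j h, sub_zero]

theorem IsAdmissible.const_mul {a : ℤ → ℤ → K} (ha : IsAdmissible a) (t : K) :
    IsAdmissible fun i j => t * a i j := by
  refine ⟨fun i j => ?_, fun i j h => ?_⟩
  · linear_combination t * ha.1 i j
  · simp only [ha.2 i j h, mul_zero]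

theorem CocycleRec.sub {a b : ℤ → ℤ → K} (ha : CocycleRec a) (hb : CocycleRec b) :
    CocycleRec fun i j => a i j - b i j := by
  intro i j hi hj
  linear_combination ha i j hi hj - hb i j hi hj

theorem CocycleRec.const_mul {a : ℤ → ℤ → K} (ha : CocycleRec a) (t : K) :
    CocycleRec fun i j => t * a i j := by
  intro i j hi hj
  linear_combination t * ha i j hi hj

theorem MasseySq.const_mul {l : ℤ} {a : ℤ → ℤ → K} (t : K) (i j k : ℤ) :
    MasseySq l (fun i j => t * a i j) i j k = t ^ 2 * MasseySq l a i j k := by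
  simp only [MasseySq]
  ring

/-- The expansion of the weight-zero square, with every value of `a` taken at increasing
arguments when `i < j < k < i + j`. -/
theorem IsAdmissible.masseySq_zero {a : ℤ → ℤ → K} (ha : IsAdmissible a) (i j k : ℤ) :
    MasseySq 0 a i j k =
      -(a i j * a k (i + j)) - a j k * a i (j + k) + a i k * a j (i + k) := by
  simp only [MasseySq, add_zero]
  rw [ha.1 k (i + j), ha.1 i (j + k), ha.1 i k, ha.1 j (k + i), add_comm k i]
  ring

section Antidiagonals

variable {d : ℤ → ℤ → K} {m : ℤ}

theorem CocycleRec.antidiagonal_even (hr : CocycleRec d)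
    (h : ∀ i j, i + j < 2 * m → d i j = 0) (h0 : d m m = 0) (k : ℕ) (hk : 2 ≤ m - k) :
    d (m - k) (m + k) = 0 := by
  induction k with
  | zero => simpa using h0
  | succ k ih =>
    push_cast at hk ⊢
    have e := hr (m - (k + 1)) (m + k) hk (by omega)
    rw [h (m - (k + 1)) (m + k) (by omega), show m - ((k : ℤ) + 1) + 1 = m - k by ring,
      ih (by omega), zero_add] at e
    rw [← add_assoc, e]

theorem CocycleRec.antidiagonal_odd (hr : CocycleRec d)
    (h : ∀ i j, i + j < 2 * m + 1 → d i j = 0) (k : ℕ) (hk : 2 ≤ m - k) :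
    d (m - k) (m + 1 + k) = (-1) ^ k * d m (m + 1) := by
  induction k with
  | zero => simp
  | succ k ih =>
    push_cast at hk ⊢
    have e := hr (m - (k + 1)) (m + 1 + k) hk (by omega)
    rw [h (m - (k + 1)) (m + 1 + k) (by omega), show m - ((k : ℤ) + 1) + 1 = m - k by ring,
      ih (by omega)] at e
    rw [← add_assoc]
    linear_combination e

theorem CocycleRec.antidiagonal_add_two (hr : CocycleRec d) (h0 : d (m + 1) (m + 1) = 0)
    (h : ∀ i j, i + j < 2 * m + 1 → d i j = 0) (k : ℕ) (hk : 2 ≤ m - k) :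
    d (m - k) (m + 2 + k) = (-1) ^ k * (k + 1) * d m (m + 1) := by
  induction k with
  | zero =>
    have e := hr m (m + 1) (by simpa using hk) (by omega)
    rw [h0, add_assoc] at e
    simpa using e
  | succ k ih =>
    have e' := hr.antidiagonal_odd h (k + 1) hk
    push_cast at hk e' ⊢
    have e := hr (m - (k + 1)) (m + 2 + k) hk (by omega)
    rw [show m - ((k : ℤ) + 1) + 1 = m - k by ring, ih (by omega),
      show m + 2 + (k : ℤ) = m + 1 + (k + 1) by ring, e'] at e
    rw [show m + 2 + ((k : ℤ) + 1) = m + 1 + (k + 1) + 1 by ring]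
    linear_combination e

theorem CocycleRec.antidiagonal_add_three [CharZero K] (hr : CocycleRec d)
    (h0 : d (m + 1) (m + 1) = 0)
    (h : ∀ i j, i + j < 2 * m + 1 → d i j = 0) (k : ℕ) (hk : 2 ≤ m - k) :
    d (m - k) (m + 3 + k) =
      (-1) ^ k * ((k + 1) * (k + 2) / 2 * d m (m + 1) - d (m + 1) (m + 2)) := by
  induction k with
  | zero =>
    have e := hr m (m + 2) (by simpa using hk) (by simp at hk; omega)
    have e' := hr.antidiagonal_add_two h0 h 0 hk
    simp only [Nat.cast_zero, sub_zero, add_zero, pow_zero] at e' ⊢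
    rw [show m + 2 + 1 = m + 3 by ring] at e
    linear_combination e + e'
  | succ k ih =>
    have e' := hr.antidiagonal_add_two h0 h (k + 1) hk
    push_cast at hk e' ⊢
    have e := hr (m - (k + 1)) (m + 3 + k) hk (by omega)
    rw [show m - ((k : ℤ) + 1) + 1 = m - k by ring, ih (by omega),
      show m + 3 + (k : ℤ) = m + 2 + (k + 1) by ring, e'] at e
    rw [show m + 3 + ((k : ℤ) + 1) = m + 2 + (k + 1) + 1 by ring]
    linear_combination e

theorem CocycleRec.antidiagonal_add_four [CharZero K] (hr : CocycleRec d)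
    (h0 : d (m + 1) (m + 1) = 0) (h0' : d (m + 2) (m + 2) = 0)
    (h : ∀ i j, i + j < 2 * m + 1 → d i j = 0) (k : ℕ) (hk : 2 ≤ m - k) :
    d (m - k) (m + 4 + k) =
      (-1) ^ k * ((k + 1) * (k + 2) * (k + 3) / 6 * d m (m + 1)
        - (k + 2) * d (m + 1) (m + 2)) := by
  induction k with
  | zero =>
    simp only [Nat.cast_zero, sub_zero] at hk
    have e := hr m (m + 3) hk (by omega)
    have e₁ := hr (m + 1) (m + 2) (by omega) (by omega)
    have e' := hr.antidiagonal_add_three h0 h 0 (by simpa using hk)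
    simp only [Nat.cast_zero, sub_zero, add_zero, pow_zero] at e' ⊢
    rw [show m + 3 + 1 = m + 4 by ring] at e
    rw [show m + 2 + 1 = m + 3 by ring, show m + 1 + 1 = m + 2 by ring, h0'] at e₁
    linear_combination e + e' - e₁
  | succ k ih =>
    have e' := hr.antidiagonal_add_three h0 h (k + 1) hk
    push_cast at hk e' ⊢
    have e := hr (m - (k + 1)) (m + 4 + k) hk (by omega)
    rw [show m - ((k : ℤ) + 1) + 1 = m - k by ring, ih (by omega),
      show m + 4 + (k : ℤ) = m + 3 + (k + 1) by ring, e'] at e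
    rw [show m + 4 + ((k : ℤ) + 1) = m + 3 + (k + 1) + 1 by ring]
    linear_combination e

end Antidiagonals

/-- An admissible solution of the recurrence vanishes as soon as each `d m (m + 1)` does
whenever `d` vanishes on all lower antidiagonals. -/
theorem CocycleRec.eq_zero_of_step [CharZero K] {d : ℤ → ℤ → K} (hd : IsAdmissible d)
    (hr : CocycleRec d)
    (hstep : ∀ m, 2 ≤ m → (∀ i j, i + j < 2 * m + 1 → d i j = 0) → d m (m + 1) = 0)
    (i j : ℤ) : d i j = 0 := by
  have key : ∀ n : ℕ, ∀ i j : ℤ, i + j < n → d i j = 0 := by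
    intro n
    induction n with
    | zero =>
      intro i j hij
      exact hd.2 i j (by push_cast at hij; omega)
    | succ n ih =>
      have main : ∀ i j : ℤ, 2 ≤ i → i < j → i + j < (n : ℤ) + 1 → d i j = 0 := by
        intro i j hi hij hn
        by_cases hlt : i + j < n
        · exact ih i j hlt
        obtain ⟨m, hm | hm⟩ := Int.even_or_odd' (i + j)
        · have e := hr.antidiagonal_even (m := m) (fun i j h => ih i j (by omega))
            (hd.self_eq_zero m) (m - i).toNat (by omega)
          rwa [show m - ((m - i).toNat : ℤ) = i by omega,
            show m + ((m - i).toNat : ℤ) = j by omega] at e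
        · have hv : ∀ i j, i + j < 2 * m + 1 → d i j = 0 := fun i j h => ih i j (by omega)
          have e := hr.antidiagonal_odd hv (m - i).toNat (by omega)
          rwa [show m - ((m - i).toNat : ℤ) = i by omega,
            show m + 1 + ((m - i).toNat : ℤ) = j by omega, hstep m (by omega) hv,
            mul_zero] at e
      intro i j hij
      push_cast at hij
      by_cases h1 : i ≤ 1 ∨ j ≤ 1
      · exact hd.2 i j h1
      push Not at h1
      rcases lt_trichotomy i j with hlt | rfl | hlt
      · exact main i j (by omega) hlt hij
      · exact hd.self_eq_zero i
      · rw [hd.1 j i, main j i (by omega) hlt (by omega), neg_zero]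
  exact key (i + j + 1).toNat i j (by omega)

/-- A solution is determined by its values at `(2, 3)` and `(3, 4)` as long as the equations
`M_0(2, m - 1, m) = 0` can be solved for the value at `(m, m + 1)`. -/
theorem CocycleRec.eq_of_leading_ne_zero [CharZero K] {a b : ℤ → ℤ → K}
    (ha : IsAdmissible a) (hb : IsAdmissible b) (ra : CocycleRec a) (rb : CocycleRec b)
    (Ma : ∀ i j k : ℤ, MasseySq 0 a i j k = 0) (Mb : ∀ i j k : ℤ, MasseySq 0 b i j k = 0)
    (h23 : a 2 3 = b 2 3) (h34 : a 3 4 = b 3 4)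
    (hne : ∀ n : ℕ, b 2 (n + 3) + b 2 (n + 4) + (-1) ^ n * b (n + 3) (n + 4) ≠ 0) (i j : ℤ) :
    a i j = b i j := by
  refine sub_eq_zero.mp ((ra.sub rb).eq_zero_of_step (ha.sub hb) (fun m hm hv => ?_) i j)
  have hm' : m = 2 ∨ m = 3 ∨ 4 ≤ m := by omega
  rcases hm' with rfl | rfl | hm4
  · exact sub_eq_zero.mpr h23
  · exact sub_eq_zero.mpr h34
  obtain ⟨n, rfl⟩ : ∃ n : ℕ, m = n + 4 := ⟨(m - 4).toNat, by omega⟩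
  have e₁ := (ra.sub rb).antidiagonal_odd hv 1 (by push_cast; omega)
  have e₂ := (ra.sub rb).antidiagonal_odd hv (n + 2) (by push_cast; omega)
  have f₁ := sub_eq_zero.mp (hv 2 (n + 3) (by omega))
  have f₂ := sub_eq_zero.mp (hv 2 (n + 4) (by omega))
  have f₃ := sub_eq_zero.mp (hv (n + 3) (n + 4) (by omega))
  have A := Ma 2 (n + 3) (n + 4)
  have B := Mb 2 (n + 3) (n + 4)
  rw [ha.masseySq_zero, f₁, f₂, f₃] at A
  rw [hb.masseySq_zero] at B
  push_cast at e₁ e₂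
  rw [show (n : ℤ) + 4 - 1 = n + 3 by ring, show (n : ℤ) + 4 + 1 + 1 = n + 6 by ring] at e₁
  rw [show (n : ℤ) + 4 - (n + 2) = 2 by ring,
    show (n : ℤ) + 4 + 1 + (n + 2) = 2 * n + 7 by ring] at e₂
  rw [show (2 : ℤ) + (n + 3) = n + 4 + 1 by ring, show (2 : ℤ) + (n + 4) = n + 6 by ring,
    show (n : ℤ) + 3 + (n + 4) = 2 * n + 7 by ring] at A B
  refine (mul_eq_zero.mp ?_).resolve_left (hne n)
  linear_combination B - A - b (n + 3) (n + 4) * e₂ + b 2 (n + 4) * e₁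

/-- A solution vanishing at `(2, 3)` and `(3, 4)` is zero. -/
theorem CocycleRec.eq_zero_of_leading_eq_zero [CharZero K] {a : ℤ → ℤ → K}
    (ha : IsAdmissible a) (ra : CocycleRec a) (Ma : ∀ i j k : ℤ, MasseySq 0 a i j k = 0)
    (h23 : a 2 3 = 0) (h34 : a 3 4 = 0) (i j : ℤ) : a i j = 0 := by
  refine ra.eq_zero_of_step ha (fun m hm hv => ?_) i j
  have hm' : m = 2 ∨ m = 3 ∨ 4 ≤ m := by omega
  rcases hm' with rfl | rfl | hm4
  · exact h23
  · exact h34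
  obtain ⟨n, rfl⟩ : ∃ n : ℕ, m = n + 4 := ⟨(m - 4).toNat, by omega⟩
  by_contra hne
  have vanish : ∀ k, k + 1 ≤ (n : ℤ) + 4 → a k (2 * n + 9) = 0 := by
    intro k hk
    have A := Ma k (n + 4) (n + 4 + 1)
    rw [ha.masseySq_zero, hv k (n + 4) (by omega), hv k (n + 4 + 1) (by omega),
      show (n : ℤ) + 4 + (n + 4 + 1) = 2 * n + 9 by ring] at A
    refine (mul_eq_zero.mp ?_).resolve_left hne
    linear_combination -A
  have e₃ := ra.antidiagonal_add_three (ha.self_eq_zero _) hv (n + 2) (by push_cast; omega)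
  have e₄ := ra.antidiagonal_add_four (ha.self_eq_zero _) (ha.self_eq_zero _) hv (n + 1)
    (by push_cast; omega)
  push_cast at e₃ e₄
  rw [show (n : ℤ) + 4 - (n + 2) = 2 by ring,
    show (n : ℤ) + 4 + 3 + (n + 2) = 2 * n + 9 by ring, vanish 2 (by omega)] at e₃
  rw [show (n : ℤ) + 4 - (n + 1) = 3 by ring,
    show (n : ℤ) + 4 + 4 + (n + 1) = 2 * n + 9 by ring, vanish 3 (by omega)] at e₄
  have g₃ := (mul_eq_zero.mp e₃.symm).resolve_left (pow_ne_zero _ (by simp))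
  have g₄ := (mul_eq_zero.mp e₄.symm).resolve_left (pow_ne_zero _ (by simp))
  have h : ((n + 3 : ℕ) : K) * ((n + 4 : ℕ) : K) * ((2 * n + 7 : ℕ) : K)
      * a (n + 4) (n + 4 + 1) = 0 := by
    push_cast
    linear_combination 6 * (n + 3) * g₃ - 6 * g₄
  have h' := (mul_eq_zero.mp h).resolve_right hne
  norm_cast at h'

/-- The first three equations leave only the two initial directions `y = 0` and
`x : y = 10 : 1`, where `x = a 2 3` and `y = a 3 4`. -/
theorem CocycleRec.initial_values [CharZero K] {a : ℤ → ℤ → K}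
    (ha : IsAdmissible a) (ra : CocycleRec a) (Ma : ∀ i j k : ℤ, MasseySq 0 a i j k = 0) :
    a 3 4 = 0 ∨ a 2 3 ≠ 0 ∧ a 2 3 = 10 * a 3 4 := by
  have r : ∀ i j k l : ℤ, 2 ≤ i → 2 ≤ j → k = i + 1 → l = j + 1 → a i l = a i j - a k j := by
    rintro i j _ _ hi hj rfl rfl
    linear_combination ra i j hi hj
  have m₁ := Ma 2 3 4
  have m₂ := Ma 2 4 5
  have m₃ := Ma 3 4 5
  rw [ha.masseySq_zero] at m₁ m₂ m₃
  norm_num at m₁ m₂ m₃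
  have s : ∀ i, a i i = 0 := ha.self_eq_zero
  have a24 := r 2 3 3 4 (by norm_num) (by norm_num) rfl rfl
  have a25 := r 2 4 3 5 (by norm_num) (by norm_num) rfl rfl
  have a26 := r 2 5 3 6 (by norm_num) (by norm_num) rfl rfl
  have a27 := r 2 6 3 7 (by norm_num) (by norm_num) rfl rfl
  have a28 := r 2 7 3 8 (by norm_num) (by norm_num) rfl rfl
  have a29 := r 2 8 3 9 (by norm_num) (by norm_num) rfl rfl
  have a35 := r 3 4 4 5 (by norm_num) (by norm_num) rfl rfl
  have a36 := r 3 5 4 6 (by norm_num) (by norm_num) rfl rfl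
  have a37 := r 3 6 4 7 (by norm_num) (by norm_num) rfl rfl
  have a38 := r 3 7 4 8 (by norm_num) (by norm_num) rfl rfl
  have a39 := r 3 8 4 9 (by norm_num) (by norm_num) rfl rfl
  have a46 := r 4 5 5 6 (by norm_num) (by norm_num) rfl rfl
  have a47 := r 4 6 5 7 (by norm_num) (by norm_num) rfl rfl
  have a48 := r 4 7 5 8 (by norm_num) (by norm_num) rfl rfl
  have a57 := r 5 6 6 7 (by norm_num) (by norm_num) rfl rfl
  simp only [a29, a28, a27, a26, a25, a24, a39, a38, a37, a36, a35, a48, a47, a46, a57, s] at m₁ m₂ m₃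
  generalize a 2 3 = x at *
  generalize a 3 4 = y at *
  generalize a 4 5 = z at *
  generalize a 5 6 = w at *
  by_cases hy : y = 0
  · exact Or.inl hy
  have e₁ : z * (2 * x + y) = 3 * y ^ 2 := by linear_combination -m₁
  have e₂ : w * (2 * x - y - z) = 4 * y * z - 6 * z ^ 2 := by linear_combination -m₂
  have e₃ : 3 * w * (y + z) = 4 * z ^ 2 := by linear_combination -m₃
  have hz : z ≠ 0 := by
    rintro rfl
    simp [hy] at e₁
  have h₁ : z * z * (7 * z - y) = 0 := by
    linear_combination (3 * (y + z) / 2) * e₂ - ((2 * x - y - z) / 2) * e₃ - 2 * z * e₁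
  have hyz : y = 7 * z := by
    have := (mul_eq_zero.mp h₁).resolve_left (mul_ne_zero hz hz)
    linear_combination -this
  subst hyz
  have hx : x = 70 * z := by
    have : z * (x - 70 * z) = 0 := by linear_combination e₁ / 2
    linear_combination (mul_eq_zero.mp this).resolve_left hz
  refine Or.inr ⟨?_, ?_⟩
  · rw [hx]
    simpa using hz
  · rw [hx]
    ring

end Admissible

section TwoFamily

variable {K : Type*} [Field K]

theorem fam_two_eq (i j : ℤ) :
    Fam K 2 i j = (if i = 2 ∧ 3 ≤ j then 1 else 0) - if j = 2 ∧ 3 ≤ i then 1 else 0 := by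
  have aux : ∀ i j : ℤ, famAux K 2 i j = if i = 2 ∧ 3 ≤ j then 1 else 0 := by
    intro i j
    unfold famAux
    by_cases h : i = 2 ∧ 3 ≤ j
    · obtain ⟨rfl, h⟩ := h
      rw [if_pos (by omega), if_pos ⟨rfl, h⟩]
      simp
    · rw [if_neg (by omega), if_neg h]
  rw [Fam, aux, aux]

theorem isAdmissible_fam_two : IsAdmissible (Fam K 2) := by
  refine ⟨fun i j => ?_, fun i j h => ?_⟩
  · rw [fam_two_eq, fam_two_eq]
    ring
  · rw [fam_two_eq, if_neg (by omega), if_neg (by omega), sub_zero]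

theorem cocycleRec_fam_two : CocycleRec (Fam K 2) := by
  intro i j hi hj
  simp only [fam_two_eq]
  split_ifs <;> first | omega | simp

theorem masseySq_fam_two (i j k : ℤ) : MasseySq 0 (Fam K 2) i j k = 0 := by
  have h₂ : ∀ i j k : ℤ, Fam K 2 i j * Fam K 2 (i + j) k =
      if k = 2 then -Fam K 2 i j else 0 := by
    intro i j k
    simp only [fam_two_eq]
    split_ifs <;> first | omega | simp
  simp only [MasseySq, add_zero, h₂]
  simp only [fam_two_eq]
  split_ifs <;> first | omega | simp

end TwoFamily

section WittFamily

/-- The structure constants of `L₁` in the basis adapted to `𝔪₀`, extended by zero to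
indices `≤ 1`. -/
def wittFam (K : Type*) [Field K] (i j : ℤ) : K :=
  if 2 ≤ i ∧ 2 ≤ j then
    ((j - i : ℤ) : K) * ((i - 2).toNat.factorial : K) * ((j - 2).toNat.factorial : K) /
      ((i + j - 2).toNat.factorial : K)
  else 0

variable {K : Type*} [Field K]

theorem isAdmissible_wittFam : IsAdmissible (wittFam K) := by
  refine ⟨fun i j => ?_, fun i j h => if_neg (by omega)⟩
  unfold wittFam
  by_cases h : 2 ≤ i ∧ 2 ≤ j
  · rw [if_pos h, if_pos h.symm, add_comm j i]
    push_cast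
    ring
  · rw [if_neg h, if_neg (by omega), neg_zero]

theorem wittFam_add_two (m n : ℕ) :
    wittFam K (m + 2) (n + 2) = ((n : K) - m) * m.factorial * n.factorial /
      ((m + n + 2).factorial : K) := by
  unfold wittFam
  rw [if_pos (by omega), show ((m : ℤ) + 2 - 2).toNat = m by omega,
    show ((n : ℤ) + 2 - 2).toNat = n by omega,
    show ((m : ℤ) + 2 + (n + 2) - 2).toNat = m + n + 2 by omega]
  push_cast
  ring

theorem cocycleRec_wittFam [CharZero K] : CocycleRec (wittFam K) := by
  intro i j hi hj
  obtain ⟨m, rfl⟩ : ∃ m : ℕ, i = m + 2 := ⟨(i - 2).toNat, by omega⟩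
  obtain ⟨n, rfl⟩ : ∃ n : ℕ, j = n + 2 := ⟨(j - 2).toNat, by omega⟩
  have e₁ := wittFam_add_two (K := K) (m + 1) n
  have e₂ := wittFam_add_two (K := K) m (n + 1)
  push_cast at e₁ e₂
  rw [show (m : ℤ) + 2 + 1 = m + 1 + 2 by ring, show (n : ℤ) + 2 + 1 = n + 1 + 2 by ring, e₁, e₂,
    wittFam_add_two, show m + 1 + n + 2 = m + n + 2 + 1 by ring,
    show m + (n + 1) + 2 = m + n + 2 + 1 by ring, Nat.factorial_succ m, Nat.factorial_succ n,
    Nat.factorial_succ (m + n + 2)]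
  have h₁ : ((m + n + 2).factorial : K) ≠ 0 := Nat.cast_ne_zero.mpr (Nat.factorial_ne_zero _)
  have h₂ : (m : K) + n + 2 + 1 ≠ 0 := by exact_mod_cast Nat.succ_ne_zero (m + n + 2)
  push_cast
  field_simp
  ring

theorem masseySq_wittFam [CharZero K] (i j k : ℤ) : MasseySq 0 (wittFam K) i j k = 0 := by
  have hz := (isAdmissible_wittFam (K := K)).2
  simp only [MasseySq, add_zero]
  by_cases h : i ≤ 1 ∨ j ≤ 1 ∨ k ≤ 1
  · rcases h with h | h | h
    · rw [hz i j (.inl h), hz _ i (.inr h), hz k i (.inr h)]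
      ring
    · rw [hz i j (.inr h), hz j k (.inl h), hz _ j (.inr h)]
      ring
    · rw [hz j k (.inr h), hz _ k (.inr h), hz k i (.inl h)]
      ring
  push Not at h
  have prod : ∀ l m n : ℕ, wittFam K (l + 2) (m + 2) * wittFam K (l + 2 + (m + 2)) (n + 2) =
      ((m : K) - l) * (n - l - m - 2) * (l.factorial * m.factorial * n.factorial /
        ((l + m + n + 4).factorial : K)) := by
    intro l m n
    have e := wittFam_add_two (K := K) (l + m + 2) n
    push_cast at e
    rw [show (l : ℤ) + 2 + (m + 2) = l + m + 2 + 2 by ring, e, wittFam_add_two,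
      show l + m + 2 + n + 2 = l + m + n + 4 by ring]
    have h₁ : ((l + m + 2).factorial : K) ≠ 0 := Nat.cast_ne_zero.mpr (Nat.factorial_ne_zero _)
    have h₂ : ((l + m + n + 4).factorial : K) ≠ 0 :=
      Nat.cast_ne_zero.mpr (Nat.factorial_ne_zero _)
    field_simp
    ring
  obtain ⟨l, rfl⟩ : ∃ l : ℕ, i = l + 2 := ⟨(i - 2).toNat, by omega⟩
  obtain ⟨m, rfl⟩ : ∃ m : ℕ, j = m + 2 := ⟨(j - 2).toNat, by omega⟩
  obtain ⟨n, rfl⟩ : ∃ n : ℕ, k = n + 2 := ⟨(k - 2).toNat, by omega⟩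
  rw [prod, prod, prod, show m + n + l + 4 = l + m + n + 4 by ring,
    show n + l + m + 4 = l + m + n + 4 by ring]
  ring

theorem cast_wittFam [CharZero K] (i j : ℤ) : ((wittFam ℚ i j : ℚ) : K) = wittFam K i j := by
  unfold wittFam
  split_ifs <;> push_cast <;> rfl

theorem wittFam_leading_ne_zero [CharZero K] (n : ℕ) :
    wittFam K 2 (n + 3) + wittFam K 2 (n + 4) + (-1) ^ n * wittFam K (n + 3) (n + 4) ≠ 0 := by
  have e₁ := wittFam_add_two (K := ℚ) 0 (n + 1)
  have e₂ := wittFam_add_two (K := ℚ) 0 (n + 2)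
  have e₃ := wittFam_add_two (K := ℚ) (n + 1) (n + 2)
  push_cast at e₁ e₂ e₃
  norm_num [add_assoc] at e₁ e₂ e₃
  have pos : 0 < wittFam ℚ 2 (n + 3) := by
    rw [e₁]
    positivity
  have nonneg : 0 ≤ wittFam ℚ (n + 3) (n + 4) := by
    rw [e₃]
    positivity
  have le : wittFam ℚ (n + 3) (n + 4) ≤ wittFam ℚ 2 (n + 4) := by
    have hfac := Nat.le_of_dvd (Nat.factorial_pos _)
      (Nat.factorial_mul_factorial_dvd_factorial_add (n + 1) (n + 4))
    rw [add_assoc n 1 (n + 4)] at hfac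
    have hle : ((n + 1).factorial : ℚ) * (n + 4).factorial ≤ (n + (1 + (n + 4))).factorial := by
      exact_mod_cast hfac
    have hn : (1 : ℚ) ≤ n + 2 := by linarith [n.cast_nonneg (α := ℚ)]
    rw [e₂, e₃, div_le_div_iff₀ (by positivity) (by positivity)]
    calc ((n + 1).factorial : ℚ) * (n + 2).factorial * (n + 4).factorial
        = 1 * (n + 2).factorial * ((n + 1).factorial * (n + 4).factorial) := by ring
      _ ≤ (n + 2) * (n + 2).factorial * (n + (1 + (n + 4))).factorial := by gcongr
  have key : wittFam ℚ 2 (n + 3) + wittFam ℚ 2 (n + 4)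
      + (-1) ^ n * wittFam ℚ (n + 3) (n + 4) ≠ 0 := by
    rcases neg_one_pow_eq_or ℚ n with h | h <;> rw [h] <;> linarith
  simp only [← cast_wittFam (K := K)]
  exact_mod_cast key

end WittFamily

/-- In weight 0 there are exactly two true deformations of `𝔪₀` up to scalar: an
admissible `a` satisfies the cocycle recurrence and has all weight-0 Massey squares
zero if and only if it is a scalar multiple of the 2-family (deforming `𝔪₀` to `𝔪₂`)
or of the family `a(i,j) = (j-i)·(i-2)!·(j-2)!/(i+j-2)!` (deforming `𝔪₀` to `L₁`). -/
theorem weight_zero_true_deformations (K : Type*) [Field K] [CharZero K]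
    (a : ℤ → ℤ → K) (ha : IsAdmissible a) :
    (CocycleRec a ∧ ∀ i j k : ℤ, MasseySq 0 a i j k = 0) ↔
    ∃ t : K,
      (∀ i j : ℤ, a i j = t * Fam K 2 i j) ∨
      (∀ i j : ℤ, 2 ≤ i → i < j →
        a i j = t * ((j - i : ℤ) : K) * ((i - 2).toNat.factorial : K) *
          ((j - 2).toNat.factorial : K) / ((i + j - 2).toNat.factorial : K)) := by
  constructor
  · rintro ⟨ra, Ma⟩
    rcases ra.initial_values ha Ma with h34 | ⟨h23, h34⟩
    · refine ⟨a 2 3, Or.inl ?_⟩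
      by_cases h23 : a 2 3 = 0
      · intro i j
        rw [ra.eq_zero_of_leading_eq_zero ha Ma h23 h34 i j, h23, zero_mul]
      · refine ra.eq_of_leading_ne_zero ha (isAdmissible_fam_two.const_mul _)
          (cocycleRec_fam_two.const_mul _) Ma
          (fun i j k => by rw [MasseySq.const_mul, masseySq_fam_two, mul_zero]) ?_ ?_ fun n => ?_
        · simp [fam_two_eq]
        · simp [fam_two_eq, h34]
        · have h₁ : (3 : ℤ) ≤ n + 3 := by omega
          have h₂ : (3 : ℤ) ≤ n + 4 := by omega
          have h₃ : (n : ℤ) + 3 ≠ 2 := by omega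
          have h₄ : (n : ℤ) + 4 ≠ 2 := by omega
          simp only [fam_two_eq, h₁, h₂, h₃, h₄]
          norm_num
          simpa [← two_mul] using h23
    · refine ⟨6 * a 2 3, Or.inr fun i j hi hij => ?_⟩
      have h := ra.eq_of_leading_ne_zero ha (isAdmissible_wittFam.const_mul (6 * a 2 3))
          (cocycleRec_wittFam.const_mul _) Ma
          (fun i j k => by rw [MasseySq.const_mul, masseySq_wittFam, mul_zero]) ?_ ?_
          (fun n => ?_) i j
      · rw [h, wittFam, if_pos (by omega)]
        ring
      · have e := wittFam_add_two (K := K) 0 1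
        norm_num [Nat.factorial] at e
        rw [e]
        ring
      · have e := wittFam_add_two (K := K) 1 2
        norm_num [Nat.factorial] at e
        rw [e, h34]
        ring
      · have h := mul_ne_zero (mul_ne_zero (by norm_num : (6 : K) ≠ 0) h23)
          (wittFam_leading_ne_zero (K := K) n)
        contrapose! h
        linear_combination h
  · rintro ⟨t, h | h⟩
    · obtain rfl : a = fun i j => t * Fam K 2 i j := funext₂ h
      exact ⟨cocycleRec_fam_two.const_mul t,
        fun i j k => by rw [MasseySq.const_mul, masseySq_fam_two, mul_zero]⟩
    · obtain rfl : a = fun i j => t * wittFam K i j := by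
        have hw := (isAdmissible_wittFam (K := K)).const_mul t
        refine funext₂ (ha.ext hw (fun i => ?_) fun i j hi hij => ?_)
        · rw [ha.self_eq_zero, hw.self_eq_zero]
        · rw [h i j hi hij, wittFam, if_pos (by omega)]
          ring
      exact ⟨cocycleRec_wittFam.const_mul t,
        fun i j k => by rw [MasseySq.const_mul, masseySq_wittFam, mul_zero]⟩
end
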